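/- (Performance bound of Theorem 2.) Let X be a real n × K matrix with linearly independent columns, D an n × n diagonal matrix with diagonal entries in (0,1] summing to 1, P an n × n row-stochastic matrix, r ∈ ℝⁿ, γ ∈ [0, 1), η > 0, ξ ∈ (0, 1), and assume γ ‖X‖ ‖P‖_D ≤ 2(1 − ξ)√η where ‖P‖_D := ‖D^{1/2} P D^{−1/2}‖. Let q := (I − γP)⁻¹ r, let Π_D := X(XᵀDX)⁻¹XᵀD, and let w*_η be the unique solution of (Xᵀ D (I − γP) X + ηI) w = Xᵀ D r. Then ‖X w*_η − q‖ ≤ (1/ξ) · ( (σ_max(X)² / (σ_min(X)⁴ σ_min(D)^{2.5})) ‖q‖ η + ‖Π_D q − q‖ ), where σ_max(·) and σ_min(·) denote the largest and smallest singular values and σ_min(D) is the smallest diagonal entry of D. -/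

import Mathlib

open Matrix

/-- The operator norm of a real matrix induced by the Euclidean norms
(i.e., its largest singular value). -/
noncomputable def opNorm {m n : Type*} [Fintype m] [Fintype n] [DecidableEq n]
    (M : Matrix m n ℝ) : ℝ :=
  ‖LinearMap.toContinuousLinearMap (Matrix.toEuclideanLin M)‖

/-- The Euclidean norm of a plain vector. -/
noncomputable def evnorm {n : Type*} [Fintype n] (v : n → ℝ) : ℝ :=
  ‖(WithLp.equiv 2 (n → ℝ)).symm v‖

/-- The smallest singular value of a real matrix: the infimum of `‖Mv‖` over
Euclidean-unit vectors `v`. -/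
noncomputable def sigmaMin {m n : Type*} [Fintype m] [Fintype n]
    (M : Matrix m n ℝ) : ℝ :=
  sInf {c : ℝ | ∃ v : n → ℝ, evnorm v = 1 ∧ c = evnorm (M.mulVec v)}


theorem evnorm_nonneg' {n : Type*} [Fintype n] (v : n → ℝ) : 0 ≤ evnorm v := norm_nonneg _

theorem le_of_sq_le_sq_aux {a b : ℝ} (h : a ^ 2 ≤ b ^ 2) (hb : 0 ≤ b) : a ≤ b :=
  abs_le_of_sq_le_sq' h hb |>.2

theorem evnorm_sq' {n : Type*} [Fintype n] (v : n → ℝ) : evnorm v ^ 2 = v ⬝ᵥ v := by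
  unfold evnorm
  rw [EuclideanSpace.norm_sq_eq]
  simp [dotProduct, pow_two]

theorem evnorm_add_le' {n : Type*} [Fintype n] (v w : n → ℝ) :
    evnorm (v + w) ≤ evnorm v + evnorm w := by
  unfold evnorm
  exact norm_add_le (WithLp.toLp 2 v) (WithLp.toLp 2 w)

theorem dot_le_evnorm {n : Type*} [Fintype n] (v w : n → ℝ) :
    v ⬝ᵥ w ≤ evnorm v * evnorm w := by
  have h := real_inner_le_norm (WithLp.toLp 2 v) (WithLp.toLp 2 w)
  have h2 : inner ℝ (WithLp.toLp 2 v) (WithLp.toLp 2 w) = v ⬝ᵥ w := by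
    simp [PiLp.inner_apply, dotProduct, mul_comm]
  rw [h2] at h
  exact h

theorem evnorm_mulVec_le {m n : Type*} [Fintype m] [Fintype n] [DecidableEq n]
    (M : Matrix m n ℝ) (v : n → ℝ) : evnorm (M.mulVec v) ≤ opNorm M * evnorm v :=
  (LinearMap.toContinuousLinearMap (Matrix.toEuclideanLin M)).le_opNorm (WithLp.toLp 2 v)

theorem opNorm_nonneg' {m n : Type*} [Fintype m] [Fintype n] [DecidableEq n]
    (M : Matrix m n ℝ) : 0 ≤ opNorm M := norm_nonneg _

theorem evnorm_smul' {n : Type*} [Fintype n] (c : ℝ) (v : n → ℝ) :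
    evnorm (c • v) = |c| * evnorm v :=
  norm_smul c (WithLp.toLp 2 v)

theorem sigmaMin_bdd {m n : Type*} [Fintype m] [Fintype n] (M : Matrix m n ℝ) :
    BddBelow {c : ℝ | ∃ v : n → ℝ, evnorm v = 1 ∧ c = evnorm (M.mulVec v)} :=
  ⟨0, by rintro c ⟨v, _, rfl⟩; exact evnorm_nonneg' _⟩

theorem sigmaMin_nonneg {m n : Type*} [Fintype m] [Fintype n] (M : Matrix m n ℝ) :
    0 ≤ sigmaMin M :=
  Real.sInf_nonneg (by rintro c ⟨v, _, rfl⟩; exact evnorm_nonneg' _)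

theorem sigmaMin_mul_le {m n : Type*} [Fintype m] [Fintype n] (M : Matrix m n ℝ) (v : n → ℝ) :
    sigmaMin M * evnorm v ≤ evnorm (M.mulVec v) := by
  rcases (evnorm_nonneg' v).eq_or_lt with h | h
  · rw [← h, mul_zero]; exact evnorm_nonneg' _
  · have h1 : sigmaMin M ≤ evnorm (M.mulVec ((evnorm v)⁻¹ • v)) := by
      refine csInf_le (sigmaMin_bdd M) ⟨_, ?_, rfl⟩
      rw [evnorm_smul', abs_of_pos (inv_pos.2 h), inv_mul_cancel₀ h.ne']
    rw [Matrix.mulVec_smul, evnorm_smul', abs_of_pos (inv_pos.2 h), inv_mul_eq_div,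
      le_div_iff₀ h] at h1
    exact h1

theorem evnorm_single {n : Type*} [Fintype n] [DecidableEq n] (i : n) :
    evnorm (Pi.single i (1 : ℝ)) = 1 := by
  have h := evnorm_sq' (Pi.single i (1 : ℝ))
  rw [single_dotProduct] at h
  simp at h
  have := evnorm_nonneg' (Pi.single i (1 : ℝ))
  rcases h with h | h
  · exact h
  · linarith

theorem sigmaMin_pos {m n : Type*} [Fintype m] [Fintype n] [DecidableEq n] [Nonempty n]
    (M : Matrix m n ℝ) (hM : ∀ v, M.mulVec v = 0 → v = 0) : 0 < sigmaMin M := by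
  have hk : LinearMap.ker (Matrix.toEuclideanLin M) = ⊥ := by
    rw [LinearMap.ker_eq_bot']
    intro v hv
    have h2 : M.mulVec v.ofLp = 0 := congrArg WithLp.ofLp hv
    have := hM _ h2
    ext i
    exact congrFun this i
  obtain ⟨C, hC, hA⟩ := LinearMap.exists_antilipschitzWith _ hk
  have hC' : (0 : ℝ) < C := hC
  refine lt_of_lt_of_le (inv_pos.2 hC') (le_csInf ?_ ?_)
  · exact ⟨_, Pi.single (Classical.arbitrary n) 1, evnorm_single _, rfl⟩
  · rintro c ⟨v, hv, rfl⟩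
    have h := hA.le_mul_dist (WithLp.toLp 2 v) 0
    rw [map_zero, dist_zero_right, dist_zero_right] at h
    have h' : evnorm v ≤ C * evnorm (M.mulVec v) := h
    rw [hv] at h'
    rw [inv_le_iff_one_le_mul₀ hC', mul_comm]
    linarith

theorem sigmaMin_diag_le {n : Type*} [Fintype n] [DecidableEq n] (d : n → ℝ)
    (hd0 : ∀ i, 0 < d i) (i : n) : sigmaMin (Matrix.diagonal d) ≤ d i := by
  refine csInf_le (sigmaMin_bdd _) ⟨Pi.single i 1, evnorm_single i, ?_⟩
  have : (Matrix.diagonal d).mulVec (Pi.single i 1) = d i • Pi.single i (1 : ℝ) := by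
    ext j
    by_cases h : j = i
    · subst h; simp [Matrix.mulVec_diagonal]
    · simp [Matrix.mulVec_diagonal, h]
  rw [this, evnorm_smul', evnorm_single, abs_of_pos (hd0 i), mul_one]

theorem stoch_isUnit {n : ℕ} (P : Matrix (Fin n) (Fin n) ℝ) (hP0 : ∀ i j, 0 ≤ P i j)
    (hP1 : ∀ i, ∑ j, P i j = 1) {γ : ℝ} (hγ0 : 0 ≤ γ) (hγ1 : γ < 1) :
    IsUnit ((1 : Matrix (Fin n) (Fin n) ℝ) - γ • P).det := by
  rw [isUnit_iff_ne_zero]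
  apply det_ne_zero_of_sum_row_lt_diag
  intro k
  have h1 : ∑ j ∈ Finset.univ.erase k, ‖((1 : Matrix (Fin n) (Fin n) ℝ) - γ • P) k j‖
      = ∑ j ∈ Finset.univ.erase k, γ * P k j := by
    refine Finset.sum_congr rfl fun j hj => ?_
    have hj' : k ≠ j := (Finset.ne_of_mem_erase hj).symm
    simp [Matrix.one_apply, hj', abs_of_nonneg hγ0, abs_of_nonneg (hP0 k j)]
  rw [h1, ← Finset.mul_sum]
  have h2 := Finset.add_sum_erase Finset.univ (fun j => P k j) (Finset.mem_univ k)
  simp only [hP1] at h2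
  have h3 : ((1 : Matrix (Fin n) (Fin n) ℝ) - γ • P) k k = 1 - γ * P k k := by simp
  rw [h3, Real.norm_eq_abs]
  refine lt_of_lt_of_le ?_ (le_abs_self _)
  have : ∑ j ∈ Finset.univ.erase k, P k j = 1 - P k k := by linarith
  rw [this]
  nlinarith

theorem isUnit_of_coercive {K : Type*} [Fintype K] [DecidableEq K] (A : Matrix K K ℝ) {c : ℝ}
    (hc : 0 < c) (h : ∀ v, c * evnorm v ^ 2 ≤ v ⬝ᵥ A.mulVec v) : IsUnit A.det := by
  rw [isUnit_iff_ne_zero]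
  intro h0
  obtain ⟨v, hv, hv0⟩ := Matrix.exists_mulVec_eq_zero_iff.2 h0
  have := h v
  rw [hv0, dotProduct_zero, evnorm_sq'] at this
  have h3 : 0 < v ⬝ᵥ v := by
    have : 0 ≤ v ⬝ᵥ v := evnorm_sq' v ▸ sq_nonneg _
    refine lt_of_le_of_ne this fun h => hv (dotProduct_self_eq_zero.1 h.symm)
  nlinarith

/-- performance bound of Theorem 2:
`‖Xw*_η − q‖ ≤ (1/ξ)(σmax(X)²/(σmin(X)⁴σmin(D)^{2.5})‖q‖η + ‖Π_D q − q‖)`. -/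
theorem regularized_td_performance_bound {n K : ℕ}
    (X : Matrix (Fin n) (Fin K) ℝ)
    (hX : LinearIndependent ℝ (fun j : Fin K => fun i : Fin n => X i j))
    (d : Fin n → ℝ) (hd0 : ∀ i, 0 < d i) (hd1 : ∀ i, d i ≤ 1) (hdsum : ∑ i, d i = 1)
    (P : Matrix (Fin n) (Fin n) ℝ) (hP0 : ∀ i j, 0 ≤ P i j) (hP1 : ∀ i, ∑ j, P i j = 1)
    (r : Fin n → ℝ) {γ η ξ : ℝ} (hγ0 : 0 ≤ γ) (hγ1 : γ < 1) (hη : 0 < η)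
    (hξ0 : 0 < ξ) (hξ1 : ξ < 1)
    (D : Matrix (Fin n) (Fin n) ℝ) (hD : D = Matrix.diagonal d)
    (normPD : ℝ)
    (hPD : normPD = opNorm (Matrix.diagonal (fun i => Real.sqrt (d i)) * P *
      Matrix.diagonal fun i => (Real.sqrt (d i))⁻¹))
    (hcond : γ * opNorm X * normPD ≤ 2 * (1 - ξ) * Real.sqrt η)
    (q : Fin n → ℝ) (hq : q = ((1 : Matrix (Fin n) (Fin n) ℝ) - γ • P)⁻¹.mulVec r)
    (Pi : Matrix (Fin n) (Fin n) ℝ)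
    (hPi : Pi = X * (Xᵀ * D * X)⁻¹ * Xᵀ * D)
    (w : Fin K → ℝ)
    (hw : (Xᵀ * D * (1 - γ • P) * X + η • (1 : Matrix (Fin K) (Fin K) ℝ)).mulVec w =
      (Xᵀ * D).mulVec r) :
    evnorm (X.mulVec w - q) ≤
      (1 / ξ) * (opNorm X ^ 2 / (sigmaMin X ^ 4 * sigmaMin D ^ (2.5 : ℝ)) * evnorm q * η +
        evnorm (Pi.mulVec q - q)) := by
  subst hD
  have hr : r = q - γ • P.mulVec q := by
    have hu := stoch_isUnit P hP0 hP1 hγ0 hγ1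
    have : ((1 : Matrix (Fin n) (Fin n) ℝ) - γ • P).mulVec q = r := by
      rw [hq, Matrix.mulVec_mulVec, Matrix.mul_nonsing_inv _ hu, Matrix.one_mulVec]
    rw [← this, Matrix.sub_mulVec, Matrix.one_mulVec, Matrix.smul_mulVec]
  have hn : Nonempty (Fin n) := by
    by_contra h
    rw [not_nonempty_iff] at h
    simp at hdsum
  have hx0 := opNorm_nonneg' X
  set s := sigmaMin (Matrix.diagonal d) with hs
  have hspos : 0 < s := by
    refine sigmaMin_pos _ fun v hv => ?_
    ext i
    have := congrFun hv i
    rw [Matrix.mulVec_diagonal] at this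
    simpa [(hd0 i).ne'] using this
  have hsd : ∀ i, s ≤ d i := sigmaMin_diag_le d hd0
  have hs1 : s ≤ 1 := (hsd hn.some).trans (hd1 _)
  rcases isEmpty_or_nonempty (Fin K) with hK | hK
  · have e1 : X.mulVec w = 0 := by ext i; simp [Matrix.mulVec, dotProduct]
    have e2 : Pi.mulVec q = 0 := by
      rw [hPi, Matrix.mul_assoc, Matrix.mul_assoc, ← Matrix.mulVec_mulVec]
      ext i; simp [Matrix.mulVec, dotProduct]
    rw [e1, e2]
    have h1 : 0 ≤ opNorm X ^ 2 / (sigmaMin X ^ 4 * s ^ (2.5 : ℝ)) * evnorm q * η := by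
      have := evnorm_nonneg' q
      positivity
    have h2 := evnorm_nonneg' (0 - q)
    rw [one_div, inv_mul_eq_div, le_div_iff₀ hξ0]
    nlinarith
  set t := sigmaMin X with ht
  have htpos : 0 < t := by
    refine sigmaMin_pos _ fun v hv => ?_
    have hi : Function.Injective X.mulVec := Matrix.mulVec_injective_iff.2 hX
    exact hi (by rw [hv, Matrix.mulVec_zero])
  -- the weighted norm
  let S : Matrix (Fin n) (Fin n) ℝ := Matrix.diagonal (fun i => Real.sqrt (d i))
  have hSS : ∀ u v : Fin n → ℝ, u ⬝ᵥ (Matrix.diagonal d).mulVec v = S.mulVec u ⬝ᵥ S.mulVec v := by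
    intro u v
    simp only [S, dotProduct, Matrix.mulVec_diagonal]
    refine Finset.sum_congr rfl fun i _ => ?_
    have := Real.mul_self_sqrt (hd0 i).le
    linear_combination (-(u i * v i)) * this
  have hSle : ∀ v, evnorm (S.mulVec v) ≤ evnorm v := by
    intro v
    refine le_of_sq_le_sq_aux ?_ (evnorm_nonneg' v)
    rw [evnorm_sq', evnorm_sq', ← hSS]
    simp only [dotProduct, Matrix.mulVec_diagonal]
    refine Finset.sum_le_sum fun i _ => ?_
    nlinarith [hd1 i, mul_self_nonneg (v i)]
  have hSge : ∀ v, s * evnorm v ^ 2 ≤ evnorm (S.mulVec v) ^ 2 := by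
    intro v
    rw [evnorm_sq', evnorm_sq', ← hSS]
    simp only [dotProduct, Matrix.mulVec_diagonal, Finset.mul_sum]
    refine Finset.sum_le_sum fun i _ => ?_
    nlinarith [hsd i, mul_self_nonneg (v i)]
  set A := Xᵀ * Matrix.diagonal d * X with hA
  have hXT : ∀ (v : Fin K → ℝ) (z : Fin n → ℝ), v ⬝ᵥ (Xᵀ * Matrix.diagonal d).mulVec z
      = S.mulVec (X.mulVec v) ⬝ᵥ S.mulVec z := by
    intro v z
    rw [← hSS, ← Matrix.mulVec_mulVec, Matrix.dotProduct_mulVec, Matrix.vecMul_transpose]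
  have hAq : ∀ v, v ⬝ᵥ A.mulVec v = evnorm (S.mulVec (X.mulVec v)) ^ 2 := by
    intro v
    rw [hA, ← Matrix.mulVec_mulVec, hXT, evnorm_sq']
  set l := t ^ 2 * s with hl
  have hlpos : 0 < l := by positivity
  have hAl : ∀ v, l * evnorm v ^ 2 ≤ v ⬝ᵥ A.mulVec v := by
    intro v
    rw [hAq]
    refine le_trans ?_ (hSge _)
    have h1 : (t * evnorm v) ^ 2 ≤ evnorm (X.mulVec v) ^ 2 :=
      pow_le_pow_left₀ (mul_nonneg htpos.le (evnorm_nonneg' v)) (sigmaMin_mul_le X v) 2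
    nlinarith
  have hAu := isUnit_of_coercive A hlpos hAl
  set B := A + η • (1 : Matrix (Fin K) (Fin K) ℝ) with hB
  have hBv : ∀ v, v ⬝ᵥ B.mulVec v = v ⬝ᵥ A.mulVec v + η * evnorm v ^ 2 := by
    intro v
    rw [hB, Matrix.add_mulVec, Matrix.smul_mulVec, Matrix.one_mulVec, dotProduct_add,
      dotProduct_smul, evnorm_sq', smul_eq_mul]
  have hBu : IsUnit B.det := isUnit_of_coercive B hlpos fun v => by
    rw [hBv]; nlinarith [hAl v, sq_nonneg (evnorm v)]
  set e := X.mulVec w - q with he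
  obtain ⟨u0, hu0⟩ : ∃ u, u = A⁻¹.mulVec ((Xᵀ * Matrix.diagonal d).mulVec q) := ⟨_, rfl⟩
  have hAu0 : A.mulVec u0 = (Xᵀ * Matrix.diagonal d).mulVec q := by
    rw [hu0, Matrix.mulVec_mulVec, Matrix.mul_nonsing_inv _ hAu, Matrix.one_mulVec]
  have hPiq : Pi.mulVec q = X.mulVec u0 := by
    rw [hPi, hu0, Matrix.mulVec_mulVec, Matrix.mulVec_mulVec]
    simp only [Matrix.mul_assoc]
  obtain ⟨u1, hu1⟩ : ∃ u, u = B⁻¹.mulVec ((Xᵀ * Matrix.diagonal d).mulVec (γ • P.mulVec e)) :=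
    ⟨_, rfl⟩
  have hBu1 : B.mulVec u1 = (Xᵀ * Matrix.diagonal d).mulVec (γ • P.mulVec e) := by
    rw [hu1, Matrix.mulVec_mulVec, Matrix.mul_nonsing_inv _ hBu, Matrix.one_mulVec]
  have hBw : B.mulVec w = (Xᵀ * Matrix.diagonal d).mulVec q
      + (Xᵀ * Matrix.diagonal d).mulVec (γ • P.mulVec e) := by
    have h1 : (Xᵀ * Matrix.diagonal d * (1 - γ • P) * X + η • (1 : Matrix (Fin K) (Fin K) ℝ))
        = B - (Xᵀ * Matrix.diagonal d) * (γ • P) * X := by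
      rw [hB, hA, Matrix.mul_sub, Matrix.sub_mul, Matrix.mul_one]; abel
    rw [h1, Matrix.sub_mulVec, hr, ← Matrix.mulVec_mulVec, ← Matrix.mulVec_mulVec,
      Matrix.smul_mulVec, sub_eq_iff_eq_add] at hw
    rw [hw, he, ← Matrix.mulVec_add, ← Matrix.mulVec_add, Matrix.mulVec_sub, smul_sub]
    congr 1
    abel
  obtain ⟨u2, hu2⟩ : ∃ u, u = w - u0 - u1 := ⟨_, rfl⟩
  have hBu2 : B.mulVec u2 = -(η • u0) := by
    rw [hu2, Matrix.mulVec_sub, Matrix.mulVec_sub, hBw, hBu1]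
    have : B.mulVec u0 = (Xᵀ * Matrix.diagonal d).mulVec q + η • u0 := by
      rw [hB, Matrix.add_mulVec, hAu0, Matrix.smul_mulVec, Matrix.one_mulVec]
    rw [this]; abel
  have hediv : e = X.mulVec u1 + (X.mulVec u2 + (Pi.mulVec q - q)) := by
    rw [hPiq, hu2, Matrix.mulVec_sub, Matrix.mulVec_sub, he]; abel
  -- bounds
  have b0 : l * evnorm u0 ≤ opNorm X * evnorm q := by
    have h := hAl u0
    rw [hAu0, hXT] at h
    have h2 := dot_le_evnorm (S.mulVec (X.mulVec u0)) (S.mulVec q)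
    have h3 : evnorm (S.mulVec (X.mulVec u0)) * evnorm (S.mulVec q)
        ≤ (opNorm X * evnorm u0) * evnorm q :=
      mul_le_mul ((hSle _).trans (evnorm_mulVec_le _ _)) (hSle _) (evnorm_nonneg' _)
        (mul_nonneg hx0 (evnorm_nonneg' _))
    rcases (evnorm_nonneg' u0).eq_or_lt with h0 | h0
    · rw [← h0, mul_zero]; exact mul_nonneg hx0 (evnorm_nonneg' _)
    · refine le_of_mul_le_mul_right ?_ h0
      nlinarith
  have b2 : l * evnorm u2 ≤ η * evnorm u0 := by
    have h := hAl u2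
    have h1 := hBv u2
    rw [hBu2] at h1
    have h2 := dot_le_evnorm u2 (-(η • u0))
    have h3 : evnorm (-(η • u0)) = η * evnorm u0 := by
      rw [← neg_smul, evnorm_smul', abs_neg, abs_of_pos hη]
    rw [h3] at h2
    rcases (evnorm_nonneg' u2).eq_or_lt with h0 | h0
    · rw [← h0, mul_zero]; exact mul_nonneg hη.le (evnorm_nonneg' _)
    · refine le_of_mul_le_mul_right ?_ h0
      nlinarith [mul_nonneg hη.le (sq_nonneg (evnorm u2))]
  have hSP : evnorm (S.mulVec (γ • P.mulVec e)) ≤ γ * (normPD * evnorm e) := by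
    rw [Matrix.mulVec_smul, evnorm_smul', abs_of_nonneg hγ0]
    refine mul_le_mul_of_nonneg_left ?_ hγ0
    have h1 : S.mulVec (P.mulVec e) = (Matrix.diagonal (fun i => Real.sqrt (d i)) * P *
      Matrix.diagonal fun i => (Real.sqrt (d i))⁻¹).mulVec (S.mulVec e) := by
      rw [← Matrix.mulVec_mulVec, ← Matrix.mulVec_mulVec]
      congr 2
      ext i
      simp only [S, Matrix.mulVec_diagonal]
      have := (Real.sqrt_pos.2 (hd0 i)).ne'
      field_simp
    rw [h1]
    refine (evnorm_mulVec_le _ _).trans ?_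
    rw [hPD]
    exact mul_le_mul_of_nonneg_left (hSle e) (opNorm_nonneg' _)
  have hsq : 0 < Real.sqrt η := Real.sqrt_pos.2 hη
  have b1 : 2 * Real.sqrt η * evnorm u1 ≤ γ * (normPD * evnorm e) := by
    refine le_trans ?_ hSP
    have h1 := hBv u1
    rw [hBu1, hXT, hAq] at h1
    have h2 := dot_le_evnorm (S.mulVec (X.mulVec u1)) (S.mulVec (γ • P.mulVec e))
    refine le_of_sq_le_sq_aux ?_ (evnorm_nonneg' _)
    have h3 : Real.sqrt η ^ 2 = η := Real.sq_sqrt hη.le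
    rw [mul_pow, mul_pow, h3]
    nlinarith [sq_nonneg (2 * evnorm (S.mulVec (X.mulVec u1))
      - evnorm (S.mulVec (γ • P.mulVec e)))]
  have c1 : opNorm X * evnorm u1 ≤ (1 - ξ) * evnorm e := by
    have h1 := mul_le_mul_of_nonneg_left b1 hx0
    have h2 := mul_le_mul_of_nonneg_right hcond (evnorm_nonneg' e)
    refine le_of_mul_le_mul_left ?_ (mul_pos two_pos hsq)
    nlinarith
  have c2 : opNorm X * evnorm u2 ≤
      opNorm X ^ 2 / (t ^ 4 * s ^ (2.5 : ℝ)) * evnorm q * η := by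
    have h1 : l ^ 2 * (opNorm X * evnorm u2) ≤ opNorm X ^ 2 * evnorm q * η := by
      have i1 := mul_le_mul_of_nonneg_left b2 (mul_nonneg hlpos.le hx0)
      have i2 := mul_le_mul_of_nonneg_left b0 (mul_nonneg hη.le hx0)
      nlinarith
    have h2 : t ^ 4 * s ^ (2.5 : ℝ) ≤ l ^ 2 := by
      have : s ^ (2.5 : ℝ) ≤ s ^ (2 : ℝ) :=
        Real.rpow_le_rpow_of_exponent_ge hspos hs1 (by norm_num)
      rw [Real.rpow_two] at this
      rw [hl, mul_pow, ← pow_mul]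
      exact mul_le_mul_of_nonneg_left this (by positivity)
    have h3 : 0 < t ^ 4 * s ^ (2.5 : ℝ) := by positivity
    rw [div_mul_eq_mul_div, div_mul_eq_mul_div, le_div_iff₀ h3]
    have h4 := mul_le_mul_of_nonneg_right h2 (mul_nonneg hx0 (evnorm_nonneg' u2))
    linarith
  have f1 := evnorm_add_le' (X.mulVec u1) (X.mulVec u2 + (Pi.mulVec q - q))
  rw [← hediv] at f1
  have f2 := evnorm_add_le' (X.mulVec u2) (Pi.mulVec q - q)
  have f3 := evnorm_mulVec_le X u1
  have f4 := evnorm_mulVec_le X u2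
  rw [one_div, inv_mul_eq_div, le_div_iff₀ hξ0]
  linarith
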